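/- Let S = {g_1,…,g_s} be a finite set of real polynomials in n variables. Suppose the Moment Problem is solvable for S and that the basic closed semi-algebraic set K_S has nonempty interior. Let f be a real polynomial nonnegative on K_S, and let ε > 0 be fixed. Then there exists r(f,ε,S) ∈ ℕ such that for every r ≥ r(f,ε,S), the polynomial f + ε·θ_r lies in the preordering T_S, where θ_r := Σ_{i=1}^n Σ_{k=0}^r X_i^{2k}/k!. -/

import Mathlib

open MvPolynomial MeasureTheory

/-- `Θ_r = 1 + ∑_{j=1}^n X_j^{2r}`. -/
noncomputable def Theta (n r : ℕ) : MvPolynomial (Fin n) ℝ :=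
  1 + ∑ j : Fin n, X j ^ (2 * r)

/-- Membership in the preordering `T_S` generated by `S = {g_1,…,g_s}`: finite sums of
terms `σ_e · g_1^{e_1} ⋯ g_s^{e_s}` with `e ∈ {0,1}^s` and `σ_e` a sum of squares. -/
def InPreordering {n s : ℕ} (g : Fin s → MvPolynomial (Fin n) ℝ)
    (p : MvPolynomial (Fin n) ℝ) : Prop :=
  ∃ σ : (Fin s → Bool) → MvPolynomial (Fin n) ℝ,
    (∀ e, IsSumSq (σ e)) ∧
    p = ∑ e : Fin s → Bool, σ e * ∏ i, if e i then g i else 1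

/-- The basic closed semi-algebraic set `K_S`. -/
def KSet {n s : ℕ} (g : Fin s → MvPolynomial (Fin n) ℝ) : Set (Fin n → ℝ) :=
  {x | ∀ i, 0 ≤ eval x (g i)}

/-- The Moment Problem is solvable for `S`: every linear functional nonnegative on
`T_S` is integration with respect to some measure supported on `K_S`. -/
def MomentProblemSolvable {n s : ℕ} (g : Fin s → MvPolynomial (Fin n) ℝ) : Prop :=
  ∀ L : MvPolynomial (Fin n) ℝ →ₗ[ℝ] ℝ,
    (∀ t : MvPolynomial (Fin n) ℝ, InPreordering g t → 0 ≤ L t) →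
    ∃ μ : Measure (Fin n → ℝ),
      μ (KSet g)ᶜ = 0 ∧
      (∀ p : MvPolynomial (Fin n) ℝ, Integrable (fun x => eval x p) μ) ∧
      (∀ p : MvPolynomial (Fin n) ℝ, L p = ∫ x, eval x p ∂μ)

/-- `θ_r = ∑_{i=1}^n ∑_{k=0}^r X_i^{2k}/k!`. -/
noncomputable def smallTheta (n r : ℕ) : MvPolynomial (Fin n) ℝ :=
  ∑ i : Fin n, ∑ k ∈ Finset.range (r + 1), C ((k.factorial : ℝ)⁻¹) * X i ^ (2 * k)

lemma isSumSq_of_eq {σ : Type*} {p q : MvPolynomial σ ℝ} (h : IsSumSq p) (hq : q = p) :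
    IsSumSq q := hq ▸ h

lemma isSumSq_C {σ : Type*} {c : ℝ} (hc : 0 ≤ c) : IsSumSq (C c : MvPolynomial σ ℝ) := by
  have h := IsSumSq.mul_self (C (Real.sqrt c) : MvPolynomial σ ℝ)
  rwa [← C_mul, Real.mul_self_sqrt hc] at h

lemma isSumSq_X_pow {σ : Type*} (i : σ) (k : ℕ) :
    IsSumSq (X i ^ (2 * k) : MvPolynomial σ ℝ) := by
  rw [two_mul, pow_add]
  exact IsSumSq.mul_self _

namespace InPreordering

variable {n s : ℕ} {g : Fin s → MvPolynomial (Fin n) ℝ} {p q : MvPolynomial (Fin n) ℝ}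

lemma add (hp : InPreordering g p) (hq : InPreordering g q) : InPreordering g (p + q) := by
  obtain ⟨σ, hσ, rfl⟩ := hp
  obtain ⟨τ, hτ, rfl⟩ := hq
  refine ⟨fun e => σ e + τ e, fun e => (hσ e).add (hτ e), ?_⟩
  simp only [add_mul, Finset.sum_add_distrib]

lemma isSumSq_mul (hp : InPreordering g p) (hq : IsSumSq q) : InPreordering g (q * p) := by
  obtain ⟨σ, hσ, rfl⟩ := hp
  refine ⟨fun e => q * σ e, fun e => hq.mul (hσ e), ?_⟩
  simp only [Finset.mul_sum, mul_assoc]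

lemma of_isSumSq (hp : IsSumSq p) : InPreordering g p := by
  refine ⟨fun e => if e = fun _ => false then p else 0, fun e => ?_, ?_⟩
  · dsimp only
    split_ifs
    exacts [hp, .zero]
  · simp [ite_mul]

end InPreordering

lemma smallTheta_sub_isSumSq (n : ℕ) {r r' : ℕ} (h : r ≤ r') :
    IsSumSq (smallTheta n r' - smallTheta n r) := by
  simp only [smallTheta, ← Finset.sum_sub_distrib]
  refine IsSumSq.sum fun i _ => ?_
  rw [← Finset.sum_sdiff (Finset.range_mono (Nat.succ_le_succ h)), add_sub_cancel_right]
  exact IsSumSq.sum fun k _ => (isSumSq_C (by positivity)).mul (isSumSq_X_pow i k)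

lemma smallTheta_isSumSq (n r : ℕ) : IsSumSq (smallTheta n r) :=
  IsSumSq.sum fun i _ => IsSumSq.sum fun k _ =>
    (isSumSq_C (by positivity)).mul (isSumSq_X_pow i k)

/-- `p` is dominated by a nonnegative multiple of some `θ_r`, up to sums of squares. -/
def ThetaDominated {n : ℕ} (p : MvPolynomial (Fin n) ℝ) : Prop :=
  ∃ (M : ℝ) (r : ℕ), 0 ≤ M ∧ IsSumSq (C M * smallTheta n r - p)

namespace ThetaDominated

variable {n : ℕ} {p q : MvPolynomial (Fin n) ℝ}

lemma isSumSq_of_le {M M' : ℝ} {r r' : ℕ} (hM : 0 ≤ M) (hMM' : M ≤ M') (hr : r ≤ r')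
    (h : IsSumSq (C M * smallTheta n r - p)) : IsSumSq (C M' * smallTheta n r' - p) := by
  have h₁ := (isSumSq_C hM).mul (smallTheta_sub_isSumSq n hr)
  have h₂ := (isSumSq_C (sub_nonneg.2 hMM')).mul (smallTheta_isSumSq n r')
  refine isSumSq_of_eq ((h.add h₁).add h₂) ?_
  rw [C_sub]
  ring

lemma mono (hq : ThetaDominated q) (h : IsSumSq (q - p)) : ThetaDominated p := by
  obtain ⟨M, r, hM, hs⟩ := hq
  refine ⟨M, r, hM, ?_⟩
  refine isSumSq_of_eq (hs.add h) ?_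
  ring

lemma zero : ThetaDominated (0 : MvPolynomial (Fin n) ℝ) := ⟨0, 0, le_rfl, by simp⟩

lemma add (hp : ThetaDominated p) (hq : ThetaDominated q) : ThetaDominated (p + q) := by
  obtain ⟨M, r, hM, hs⟩ := hp
  obtain ⟨M', r', hM', hs'⟩ := hq
  refine ⟨M + M', max r r', by positivity, ?_⟩
  refine isSumSq_of_eq ((isSumSq_of_le hM le_rfl (le_max_left r r') hs).add
    (isSumSq_of_le hM' le_rfl (le_max_right r r') hs')) ?_
  rw [C_add]
  ring

lemma C_mul {c : ℝ} (hc : 0 ≤ c) (hp : ThetaDominated p) : ThetaDominated (C c * p) := by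
  obtain ⟨M, r, hM, hs⟩ := hp
  refine ⟨c * M, r, by positivity, ?_⟩
  refine isSumSq_of_eq ((isSumSq_C hc).mul hs) ?_
  rw [MvPolynomial.C_mul]
  ring

lemma of_two_mul (h : ThetaDominated (2 * p)) : ThetaDominated p := by
  convert C_mul (c := 1 / 2) (by norm_num) h using 1
  have h2 : (2 : MvPolynomial (Fin n) ℝ) = C 2 := (map_ofNat C 2).symm
  rw [h2, ← mul_assoc, ← MvPolynomial.C_mul]
  norm_num

lemma X_pow (i : Fin n) (k : ℕ) :
    ThetaDominated (X i ^ (2 * k) : MvPolynomial (Fin n) ℝ) := by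
  refine ⟨k.factorial, k, by positivity, ?_⟩
  have hk : (C (k.factorial : ℝ) * (C ((k.factorial : ℝ)⁻¹) * X i ^ (2 * k)) :
      MvPolynomial (Fin n) ℝ) = X i ^ (2 * k) := by
    rw [← mul_assoc, ← MvPolynomial.C_mul, mul_inv_cancel₀ (by positivity), C_1, one_mul]
  rw [smallTheta, ← Finset.add_sum_erase _ _ (Finset.mem_univ i), Finset.sum_range_succ, mul_add,
    mul_add, hk]
  refine isSumSq_of_eq (IsSumSq.add (s₁ := C (k.factorial : ℝ) * ∑ l ∈ Finset.range k,
    C ((l.factorial : ℝ)⁻¹) * X i ^ (2 * l)) (s₂ := C (k.factorial : ℝ) *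
    ∑ j ∈ Finset.univ.erase i, ∑ l ∈ Finset.range (k + 1),
    C ((l.factorial : ℝ)⁻¹) * X j ^ (2 * l)) ?_ ?_) ?_
  · exact (isSumSq_C (by positivity)).mul <| IsSumSq.sum fun l _ =>
      (isSumSq_C (by positivity)).mul (isSumSq_X_pow i l)
  · exact (isSumSq_C (by positivity)).mul <| IsSumSq.sum fun j _ => IsSumSq.sum fun l _ =>
      (isSumSq_C (by positivity)).mul (isSumSq_X_pow j l)
  · ring

lemma X_pow_mul_X_pow (i j : Fin n) (k l : ℕ) :
    ThetaDominated (X i ^ (2 * k) * X j ^ (2 * l) : MvPolynomial (Fin n) ℝ) := by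
  apply of_two_mul
  refine ((X_pow i (2 * k)).add (X_pow j (2 * l))).mono ?_
  refine isSumSq_of_eq (IsSumSq.mul_self (X i ^ (2 * k) - X j ^ (2 * l) : MvPolynomial (Fin n) ℝ)) ?_
  ring

lemma sum {ι : Type*} {I : Finset ι} {p : ι → MvPolynomial (Fin n) ℝ}
    (h : ∀ i ∈ I, ThetaDominated (p i)) : ThetaDominated (∑ i ∈ I, p i) :=
  Finset.sum_induction _ _ (fun _ _ => add) zero h

lemma smallTheta_mul_self (r : ℕ) : ThetaDominated (smallTheta n r * smallTheta n r) := by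
  simp only [smallTheta, Finset.sum_mul_sum]
  refine sum fun i _ => sum fun j _ => sum fun k _ => sum fun l _ => ?_
  rw [mul_mul_mul_comm, ← MvPolynomial.C_mul]
  exact (X_pow_mul_X_pow i j k l).C_mul (by positivity)

lemma mul_self (hp : ThetaDominated p) (hp' : ThetaDominated (-p)) : ThetaDominated (p * p) := by
  obtain ⟨M, r, hM, hs⟩ := hp
  obtain ⟨M', r', hM', hs'⟩ := hp'
  have h := isSumSq_of_le hM (le_max_left M M') (le_max_left r r') hs
  have h' := isSumSq_of_le hM' (le_max_right M M') (le_max_right r r') hs'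
  refine ((smallTheta_mul_self (max r r')).C_mul (mul_self_nonneg (max M M'))).mono ?_
  refine isSumSq_of_eq (h.mul h') ?_
  rw [MvPolynomial.C_mul]
  ring

lemma of_pos (hn : 0 < n) (p : MvPolynomial (Fin n) ℝ) :
    ThetaDominated p ∧ ThetaDominated (-p) := by
  induction p using MvPolynomial.induction_on with
  | C a =>
    have h := (X_pow (⟨0, hn⟩ : Fin n) 0).C_mul (abs_nonneg a)
    rw [mul_zero, pow_zero, mul_one] at h
    refine ⟨h.mono ?_, h.mono ?_⟩
    · rw [← C_sub]
      exact isSumSq_C (sub_nonneg.2 (le_abs_self a))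
    · rw [← C_neg, ← C_sub]
      exact isSumSq_C (sub_nonneg.2 (neg_le_abs a))
  | add p q hp hq =>
    refine ⟨hp.1.add hq.1, ?_⟩
    rw [neg_add]
    exact hp.2.add hq.2
  | mul_X p i hp =>
    have h := (mul_self hp.1 hp.2).add (X_pow i 1)
    refine ⟨of_two_mul (h.mono ?_), of_two_mul (h.mono ?_)⟩
    · refine isSumSq_of_eq (IsSumSq.mul_self (p - X i)) ?_
      ring
    · refine isSumSq_of_eq (IsSumSq.mul_self (p + X i)) ?_
      ring

end ThetaDominated

/-- The polynomials `p` such that `p + c (f + ε θ_r)` lies in the preordering for some `c ≥ 0`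
and some `r`. -/
noncomputable def perturbedCone {n s : ℕ} (g : Fin s → MvPolynomial (Fin n) ℝ)
    (f : MvPolynomial (Fin n) ℝ) {ε : ℝ} (hε : 0 ≤ ε) :
    PointedCone ℝ (MvPolynomial (Fin n) ℝ) where
  carrier := {p | ∃ (c : ℝ) (r : ℕ), 0 ≤ c ∧
    InPreordering g (p + C c * (f + C ε * smallTheta n r))}
  zero_mem' := ⟨0, 0, le_rfl, by simpa using InPreordering.of_isSumSq IsSumSq.zero⟩
  add_mem' := by
    rintro p q ⟨c, r, hc, hp⟩ ⟨d, t, hd, hq⟩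
    refine ⟨c + d, max r t, by positivity, ?_⟩
    have h₁ := (isSumSq_C (mul_nonneg hc hε)).mul (smallTheta_sub_isSumSq n (le_max_left r t))
    have h₂ := (isSumSq_C (mul_nonneg hd hε)).mul (smallTheta_sub_isSumSq n (le_max_right r t))
    convert (hp.add hq).add (.of_isSumSq (h₁.add h₂)) using 1
    rw [C_add, C_mul, C_mul]
    ring
  smul_mem' := by
    rintro ⟨a, ha⟩ p ⟨c, r, hc, hp⟩
    refine ⟨a * c, r, by positivity, ?_⟩
    convert hp.isSumSq_mul (isSumSq_C ha) using 1
    rw [Nonneg.mk_smul, smul_eq_C_mul, C_mul]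
    ring

/-- If no perturbation of `f` lies in the preordering, then `f` is strictly separated from the
preordering by a linear functional. -/
lemma exists_separating_functional {n s : ℕ} (hn : 0 < n) (g : Fin s → MvPolynomial (Fin n) ℝ)
    (f : MvPolynomial (Fin n) ℝ) {ε : ℝ} (hε : 0 < ε)
    (h : ∀ r, ¬ InPreordering g (f + C ε * smallTheta n r)) :
    ∃ L : MvPolynomial (Fin n) ℝ →ₗ[ℝ] ℝ, (∀ t, InPreordering g t → 0 ≤ L t) ∧ L f < 0 := by
  have hf0 : f ≠ 0 := by
    rintro rfl
    refine h 0 (.of_isSumSq ?_)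
    simpa using (isSumSq_C hε.le).mul (smallTheta_isSumSq n 0)
  have hnot : ∀ a : ℝ, 0 < a → a • f ∉ perturbedCone g f hε.le := by
    rintro a ha ⟨c, r, hc, hT⟩
    have hac : 0 < a + c := by positivity
    refine h r ?_
    have h₁ := (isSumSq_C (mul_nonneg (mul_nonneg (inv_nonneg.2 hac.le) ha.le) hε.le)).mul
      (smallTheta_isSumSq n r)
    convert (hT.isSumSq_mul (isSumSq_C (inv_nonneg.2 hac.le))).add (.of_isSumSq h₁) using 1
    have h1 : (C (a + c)⁻¹ * (C a + C c) : MvPolynomial (Fin n) ℝ) = 1 := by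
      rw [← C_add, ← C_mul, inv_mul_cancel₀ hac.ne', C_1]
    rw [smul_eq_C_mul, C_mul, C_mul]
    linear_combination (-f - C ε * smallTheta n r) * h1
  have hnonneg : ∀ x : (LinearPMap.mkSpanSingleton (σ := RingHom.id ℝ) f (-1 : ℝ) hf0).domain,
      (x : MvPolynomial (Fin n) ℝ) ∈ perturbedCone g f hε.le →
      0 ≤ LinearPMap.mkSpanSingleton f (-1 : ℝ) hf0 x := by
    rintro ⟨x, hx⟩ hxP
    obtain ⟨a, rfl⟩ := Submodule.mem_span_singleton.1 hx
    rw [LinearPMap.mkSpanSingleton'_apply]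
    have ha : a ≤ 0 := not_lt.1 fun ha => hnot a ha hxP
    simpa using ha
  have hdense : ∀ y, ∃ x : (LinearPMap.mkSpanSingleton (σ := RingHom.id ℝ) f (-1 : ℝ) hf0).domain,
      (x : MvPolynomial (Fin n) ℝ) + y ∈ perturbedCone g f hε.le := by
    intro y
    obtain ⟨M, r, hM, hs⟩ := (ThetaDominated.of_pos hn y).2
    refine ⟨⟨(-(M / ε)) • f, Submodule.smul_mem _ _ (Submodule.mem_span_singleton_self f)⟩,
      M / ε, r, by positivity, ?_⟩
    convert InPreordering.of_isSumSq hs using 1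
    have h1 : (C (M / ε) * C ε : MvPolynomial (Fin n) ℝ) = C M := by
      rw [← C_mul, div_mul_cancel₀ _ hε.ne']
    simp only [smul_eq_C_mul, C_neg]
    linear_combination smallTheta n r * h1
  obtain ⟨L, hLf, hL⟩ := riesz_extension (perturbedCone g f hε.le) _ hnonneg hdense
  refine ⟨L, fun t ht => hL t ⟨0, 0, le_rfl, by simpa using ht⟩, ?_⟩
  have h₁ := hLf ⟨f, Submodule.mem_span_singleton_self f⟩
  rw [LinearPMap.mkSpanSingleton_apply] at h₁
  simp only [h₁]
  norm_num

/-- If the Moment Problem is solvable for `S` and `K_S` has nonempty interior, then for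
any `f` nonnegative on `K_S` and `ε > 0`, the polynomial `f + ε θ_r` lies in `T_S` for
all sufficiently large `r`. -/
theorem stmt_9 (n s : ℕ) (g : Fin s → MvPolynomial (Fin n) ℝ)
    (hmp : MomentProblemSolvable g)
    (hint : (interior (KSet g)).Nonempty)
    (f : MvPolynomial (Fin n) ℝ)
    (hf : ∀ x ∈ KSet g, 0 ≤ eval x f)
    (ε : ℝ) (hε : 0 < ε) :
    ∃ r0 : ℕ, ∀ r : ℕ, r0 ≤ r → InPreordering g (f + C ε * smallTheta n r) := by
  suffices hex : ∃ r, InPreordering g (f + C ε * smallTheta n r) by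
    obtain ⟨r₀, h₀⟩ := hex
    refine ⟨r₀, fun r hr => ?_⟩
    convert h₀.add (.of_isSumSq ((isSumSq_C hε.le).mul (smallTheta_sub_isSumSq n hr))) using 1
    ring
  rcases Nat.eq_zero_or_pos n with rfl | hn
  · obtain ⟨x, hx⟩ := hint
    have hfx := hf x (interior_subset hx)
    rw [eq_C_of_isEmpty f, eval_C] at hfx
    refine ⟨0, .of_isSumSq ?_⟩
    rw [eq_C_of_isEmpty f]
    exact (isSumSq_C hfx).add ((isSumSq_C hε.le).mul (smallTheta_isSumSq 0 0))
  · by_contra! h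
    obtain ⟨L, hL, hLf⟩ := exists_separating_functional hn g f hε h
    obtain ⟨μ, hμ, -, hLμ⟩ := hmp L hL
    have hae : ∀ᵐ x ∂μ, x ∈ KSet g := hμ
    exact hLf.not_ge (hLμ f ▸ integral_nonneg_of_ae (hae.mono hf))
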